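/- Let L₁(Ψ,φ) = Σ_{i,j=1,2} ∂_i(𝔞_{ij}∂_jφ + Ψ𝔟_i) and L₂(Ψ,φ) = ΔΨ − (Ψ𝔡 + ∇φ·𝔠) be the operators obtained by linearizing the reformulated Euler–Poisson system at the subsonic background. If (φ,Ψ) ∈ (C¹(N̄) ∩ C²(N))² satisfies L₁(Ψ,φ) = 0 and L₂(Ψ,φ) = 0 in N, together with the homogeneous boundary conditions φ = 0 on Γ₀, ∂_{x₂}φ = 0 on Γ_w, ∂_{x₁}φ = 0 on Γ_L, Ψ = 0 on Γ₀∪Γ_L, and ∂_{x₂}Ψ = 0 on Γ_w, then φ ≡ 0 and Ψ ≡ 0 on N̄. -/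

import Mathlib

open Real Set Metric MeasureTheory
open scoped ENNReal

noncomputable section

abbrev Pt : Type := ℝ × ℝ

/-- partial derivative in the `x₁` direction -/
def pd1 (f : Pt → ℝ) : Pt → ℝ := fun x => fderiv ℝ f x (1, 0)

/-- partial derivative in the `x₂` direction -/
def pd2 (f : Pt → ℝ) : Pt → ℝ := fun x => fderiv ℝ f x (0, 1)

/-- mixed partial derivative `∂₁^i ∂₂^j` -/
def Dmix (i j : ℕ) (f : Pt → ℝ) : Pt → ℝ := pd1^[i] (pd2^[j] f)

/-- Laplacian -/
def lap (f : Pt → ℝ) : Pt → ℝ := fun x => pd1 (pd1 f) x + pd2 (pd2 f) x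

/-- the nozzle `N = (0,L) × (0,1)` -/
def Noz (L : ℝ) : Set Pt := Ioo 0 L ×ˢ Ioo 0 1

/-- the entrance `Γ₀ = {0} × [0,1]` -/
def Gam0 : Set Pt := {0} ×ˢ Icc 0 1

/-- the exit `Γ_L = {L} × [0,1]` -/
def GamL (L : ℝ) : Set Pt := {L} ×ˢ Icc 0 1

/-- the insulated walls `Γ_w = (0,L) × {0,1}` -/
def GamW (L : ℝ) : Set Pt := Ioo 0 L ×ˢ ({0, 1} : Set ℝ)

/-- the closed walls `Γ̄_w = [0,L] × {0,1}` -/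
def GamWbar (L : ℝ) : Set Pt := Icc 0 L ×ˢ ({0, 1} : Set ℝ)

/-- `f` is `C^m` on an open neighborhood of `K` (encoding of "`C^m` up to the boundary") -/
def UpTo (m : ℕ) (f : Pt → ℝ) (K : Set Pt) : Prop :=
  ∃ U : Set Pt, IsOpen U ∧ K ⊆ U ∧ ContDiffOn ℝ m f U

/-! ### Hölder norms (ℝ≥0∞–valued) -/

def supAbs (Ω : Set Pt) (g : Pt → ℝ) : ℝ≥0∞ := ⨆ x ∈ Ω, ENNReal.ofReal |g x|

def hSemi (α : ℝ) (Ω : Set Pt) (g : Pt → ℝ) : ℝ≥0∞ :=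
  ⨆ x ∈ Ω, ⨆ y ∈ Ω, ⨆ _ : x ≠ y, ENNReal.ofReal (|g x - g y| / ‖x - y‖ ^ α)

def idxLe (m : ℕ) : Finset (ℕ × ℕ) :=
  (Finset.range (m+1) ×ˢ Finset.range (m+1)).filter (fun p => p.1 + p.2 ≤ m)

def idxEq (m : ℕ) : Finset (ℕ × ℕ) :=
  (Finset.range (m+1) ×ˢ Finset.range (m+1)).filter (fun p => p.1 + p.2 = m)

/-- the Hölder norm `‖f‖_{m,α,Ω}` -/
def hNorm (m : ℕ) (α : ℝ) (Ω : Set Pt) (f : Pt → ℝ) : ℝ≥0∞ :=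
  ∑ p ∈ idxLe m, supAbs Ω (Dmix p.1 p.2 f) + ∑ p ∈ idxEq m, hSemi α Ω (Dmix p.1 p.2 f)

/-- the `C^k` sup norm `‖f‖_{k,Ω}` -/
def ckNorm (k : ℕ) (Ω : Set Pt) (f : Pt → ℝ) : ℝ≥0∞ :=
  ∑ p ∈ idxLe k, supAbs Ω (Dmix p.1 p.2 f)

def wSup (k : ℝ) (Γ Ω : Set Pt) (d : ℕ) (g : Pt → ℝ) : ℝ≥0∞ :=
  ⨆ x ∈ Ω, ENNReal.ofReal (infDist x Γ ^ (max ((d : ℝ) + k) 0) * |g x|)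

def wSemi (m : ℕ) (α k : ℝ) (Γ Ω : Set Pt) (g : Pt → ℝ) : ℝ≥0∞ :=
  ⨆ x ∈ Ω, ⨆ y ∈ Ω, ⨆ _ : x ≠ y,
    ENNReal.ofReal ((min (infDist x Γ) (infDist y Γ)) ^ (max ((m : ℝ) + α + k) 0) *
      (|g x - g y| / ‖x - y‖ ^ α))

/-- the weighted Hölder norm `‖f‖^{(k,Γ)}_{m,α,Ω}` -/
def whNorm (m : ℕ) (α k : ℝ) (Γ Ω : Set Pt) (f : Pt → ℝ) : ℝ≥0∞ :=
  ∑ p ∈ idxLe m, wSup k Γ Ω (p.1 + p.2) (Dmix p.1 p.2 f)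
  + ∑ p ∈ idxEq m, wSemi m α k Γ Ω (Dmix p.1 p.2 f)

/-! ### one–dimensional versions, for norms of boundary data -/

def supAbs1 (Ω : Set ℝ) (g : ℝ → ℝ) : ℝ≥0∞ := ⨆ x ∈ Ω, ENNReal.ofReal |g x|

def hSemi1 (α : ℝ) (Ω : Set ℝ) (g : ℝ → ℝ) : ℝ≥0∞ :=
  ⨆ x ∈ Ω, ⨆ y ∈ Ω, ⨆ _ : x ≠ y, ENNReal.ofReal (|g x - g y| / |x - y| ^ α)

/-- the one–dimensional Hölder norm `‖f‖_{m,α,Ω}` -/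
def h1Norm (m : ℕ) (α : ℝ) (Ω : Set ℝ) (f : ℝ → ℝ) : ℝ≥0∞ :=
  ∑ i ∈ Finset.range (m+1), supAbs1 Ω (deriv^[i] f) + hSemi1 α Ω (deriv^[m] f)

def wSup1 (k : ℝ) (Γ Ω : Set ℝ) (d : ℕ) (g : ℝ → ℝ) : ℝ≥0∞ :=
  ⨆ x ∈ Ω, ENNReal.ofReal (infDist x Γ ^ (max ((d : ℝ) + k) 0) * |g x|)

def wSemi1 (m : ℕ) (α k : ℝ) (Γ Ω : Set ℝ) (g : ℝ → ℝ) : ℝ≥0∞ :=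
  ⨆ x ∈ Ω, ⨆ y ∈ Ω, ⨆ _ : x ≠ y,
    ENNReal.ofReal ((min (infDist x Γ) (infDist y Γ)) ^ (max ((m : ℝ) + α + k) 0) *
      (|g x - g y| / |x - y| ^ α))

/-- the one–dimensional weighted Hölder norm `‖f‖^{(k,Γ)}_{m,α,Ω}` -/
def wh1Norm (m : ℕ) (α k : ℝ) (Γ Ω : Set ℝ) (f : ℝ → ℝ) : ℝ≥0∞ :=
  ∑ i ∈ Finset.range (m+1), wSup1 k Γ Ω i (deriv^[i] f) + wSemi1 m α k Γ Ω (deriv^[m] f)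

/-! ### gas quantities and the background solution -/

/-- density as a function of entropy `S` and `ζ = K + Φ − |u|²/2` -/
def Hfun (γ 𝔭 cv S ζ : ℝ) : ℝ := ((γ - 1) * ζ / (γ * 𝔭 * exp (S / cv))) ^ (1 / (γ - 1))

/-- temperature -/
def Tfun (γ 𝔭 cv ρ S : ℝ) : ℝ := (cv * 𝔭 / (γ - 1)) * exp (S / cv) * ρ ^ (γ - 1)

/-- the background Bernoulli constant `B₀ = ū(0)²/2 + γ𝔭e^{S₀/c_v}ρ₀^{γ−1}/(γ−1)` -/
def Bern0 (γ 𝔭 cv S₀ J₀ ρ₀ : ℝ) : ℝ :=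
  (J₀ / ρ₀) ^ 2 / 2 + γ * 𝔭 * exp (S₀ / cv) * ρ₀ ^ (γ - 1) / (γ - 1)

/-- the Bernoulli function of a flow `(ρ, u, v, p)` -/
def BernFn (γ : ℝ) (ρ u v p : Pt → ℝ) : Pt → ℝ :=
  fun y => (u y ^ 2 + v y ^ 2) / 2 + γ * p y / ((γ - 1) * ρ y)

/-- the background electric potential `Φ₀` -/
def Phi0 (Eb : ℝ → ℝ) : Pt → ℝ := fun x => ∫ t in (0:ℝ)..x.1, Eb t

/-- the background velocity potential `φ₀` -/
def phi0 (J₀ : ℝ) (ρb : ℝ → ℝ) : Pt → ℝ := fun x => ∫ t in (0:ℝ)..x.1, J₀ / ρb t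

/-- `(ρb, Eb)` is the subsonic background solution of Proposition 2.1 associated with the
data `(b₀, S₀, J₀, ρ₀, E₀, L)`, with density bounds `ρlow, ρhigh` and subsonicity bound `ν₀`. -/
structure Background (γ 𝔭 cv b₀ J₀ S₀ E₀ ρ₀ L ν₀ ρlow ρhigh : ℝ) (ρb Eb : ℝ → ℝ) : Prop where
  hγ : 1 < γ
  h𝔭 : 0 < 𝔭
  hcv : 0 < cv
  hb₀ : 0 < b₀
  hJ₀ : 0 < J₀
  hS₀ : 0 < S₀
  hL : 0 < L
  hν₀ : 0 < ν₀
  hρlow : 0 < ρlow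
  smooth_rho : ContDiffOn ℝ (⊤ : ℕ∞) ρb (Icc 0 L)
  smooth_E : ContDiffOn ℝ (⊤ : ℕ∞) Eb (Icc 0 L)
  init_rho : ρb 0 = ρ₀
  init_E : Eb 0 = E₀
  ode_rho : ∀ x ∈ Icc 0 L, derivWithin ρb (Icc 0 L) x =
      ρb x * Eb x / (γ * 𝔭 * exp (S₀ / cv) * ρb x ^ (γ - 1) - J₀ ^ 2 / ρb x ^ 2)
  ode_E : ∀ x ∈ Icc 0 L, derivWithin Eb (Icc 0 L) x = ρb x - b₀
  bound_lo : ∀ x ∈ Icc 0 L, ρlow ≤ ρb x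
  bound_hi : ∀ x ∈ Icc 0 L, ρb x ≤ ρhigh
  subsonic : ∀ x ∈ Icc 0 L, ν₀ ≤ γ * 𝔭 * exp (S₀ / cv) * ρb x ^ (γ - 1) - J₀ ^ 2 / ρb x ^ 2

/-! ### sizes of the perturbations -/

/-- `ω₁(b) = ‖b − b₀‖_{α,N}` -/
def om1 (α b₀ L : ℝ) (b : Pt → ℝ) : ℝ≥0∞ := hNorm 0 α (Noz L) (fun x => b x - b₀)

/-- `ω₂(S_en, B_en) = ‖(S_en,B_en) − (S₀,B₀)‖_{1,α,Γ₀}` -/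
def om2 (α S₀ B₀ : ℝ) (Sen Ben : ℝ → ℝ) : ℝ≥0∞ :=
  h1Norm 1 α (Icc 0 1) (fun t => Sen t - S₀) + h1Norm 1 α (Icc 0 1) (fun t => Ben t - B₀)

/-- `ω₃(Φ_bd, p_ex)`, where `Φ_bd` is described by its two traces `Φbd0` on `Γ₀` and
`ΦbdL` on `Γ_L` (as functions of `x₂`), and the background potential vanishes on `Γ₀`. -/
def om3 (γ 𝔭 cv S₀ α L : ℝ) (ρb Eb : ℝ → ℝ) (Φbd0 ΦbdL pex : ℝ → ℝ) : ℝ≥0∞ :=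
  wh1Norm 2 α (-1-α) {0, 1} (Icc 0 1) Φbd0
  + wh1Norm 2 α (-1-α) {0, 1} (Icc 0 1) (fun t => ΦbdL t - ∫ s in (0:ℝ)..L, Eb s)
  + wh1Norm 1 α (-α) {0, 1} (Icc 0 1) (fun t => pex t - 𝔭 * exp (S₀ / cv) * ρb L ^ γ)

/-- the `W^{2,μ}` norm on `Γ₀ ≃ [0,1]` -/
def W2mu (μ : ℝ) (f : ℝ → ℝ) : ℝ :=
  (∫ t in (0:ℝ)..1, (|f t| ^ μ + |deriv f t| ^ μ + |deriv (deriv f) t| ^ μ)) ^ (1 / μ)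

/-- `ω₄(S_en, B_en, Φ_bd) = ‖(S_en, B_en − Φ_bd) − (S₀, B₀)‖_{W^{2,μ}(Γ₀)}` -/
def om4 (μ S₀ B₀ : ℝ) (Sen Ben Φbd0 : ℝ → ℝ) : ℝ :=
  W2mu μ (fun t => Sen t - S₀) + W2mu μ (fun t => Ben t - Φbd0 t - B₀)

/-! ### the nonlinear fluxes and their linearization at the background state -/

def evec : Fin 2 → Pt := fun j => if j = 0 then (1, 0) else (0, 1)

/-- the flux `B(ς,η,z,q,s) = H(ς, η + z − |q + s^⊥|²/2)`, `s^⊥ = (s₂,−s₁)` -/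
def Bflux (γ 𝔭 cv ς η z : ℝ) (q s : Pt) : ℝ :=
  Hfun γ 𝔭 cv ς (η + z - ((q.1 + s.2) ^ 2 + (q.2 - s.1) ^ 2) / 2)

/-- the flux `A_i(ς,η,z,q,s) = B(ς,η,z,q,s)·q_i` -/
def Aflux (γ 𝔭 cv : ℝ) (i : Fin 2) (ς η z : ℝ) (q s : Pt) : ℝ :=
  Bflux γ 𝔭 cv ς η z q s * (if i = 0 then q.1 else q.2)

/-- `𝔞_{ij}(x) = ∂_{q_j}A_i(V₀(x))` at the background state
`V₀(x) = (S₀, K₀, Φ₀(x), (ū(x₁),0), 0)` -/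
def coefa (γ 𝔭 cv S₀ K₀ J₀ : ℝ) (ρb Eb : ℝ → ℝ) (i j : Fin 2) (x : Pt) : ℝ :=
  deriv (fun t : ℝ => Aflux γ 𝔭 cv i S₀ K₀ (Phi0 Eb x) ((J₀ / ρb x.1, 0) + t • evec j) (0, 0)) 0

/-- `𝔟_i(x) = ∂_z A_i(V₀(x))` -/
def coefb (γ 𝔭 cv S₀ K₀ J₀ : ℝ) (ρb Eb : ℝ → ℝ) (i : Fin 2) (x : Pt) : ℝ :=
  deriv (fun t : ℝ => Aflux γ 𝔭 cv i S₀ K₀ (Phi0 Eb x + t) (J₀ / ρb x.1, 0) (0, 0)) 0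

/-- `𝔠_i(x) = ∂_{q_i}B(V₀(x))` -/
def coefc (γ 𝔭 cv S₀ K₀ J₀ : ℝ) (ρb Eb : ℝ → ℝ) (i : Fin 2) (x : Pt) : ℝ :=
  deriv (fun t : ℝ => Bflux γ 𝔭 cv S₀ K₀ (Phi0 Eb x) ((J₀ / ρb x.1, 0) + t • evec i) (0, 0)) 0

/-- `𝔡(x) = ∂_z B(V₀(x))` -/
def coefd (γ 𝔭 cv S₀ K₀ J₀ : ℝ) (ρb Eb : ℝ → ℝ) (x : Pt) : ℝ :=
  deriv (fun t : ℝ => Bflux γ 𝔭 cv S₀ K₀ (Phi0 Eb x + t) (J₀ / ρb x.1, 0) (0, 0)) 0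

theorem closure_Noz {L : ℝ} (hL : 0 < L) : closure (Noz L) = Icc 0 L ×ˢ Icc 0 1 := by
  rw [Noz, closure_prod_eq, closure_Ioo hL.ne, closure_Ioo zero_ne_one]

theorem isOpen_Noz (L : ℝ) : IsOpen (Noz L) := isOpen_Ioo.prod isOpen_Ioo

/-- A vector field whose normal component vanishes on the boundary of the nozzle and whose
divergence is continuous and nonnegative is divergence free. -/
theorem eq_zero_of_divergence_eq {L : ℝ} (hL : 0 < L) {f g Q : Pt → ℝ}
    (hf : ContinuousOn f (closure (Noz L))) (hg : ContinuousOn g (closure (Noz L)))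
    (hQ : ContinuousOn Q (closure (Noz L)))
    (hfd : ∀ x ∈ Noz L, DifferentiableAt ℝ f x) (hgd : ∀ x ∈ Noz L, DifferentiableAt ℝ g x)
    (hdiv : ∀ x ∈ Noz L, pd1 f x + pd2 g x = Q x) (hQ0 : ∀ x ∈ Noz L, 0 ≤ Q x)
    (hf0 : ∀ t ∈ Icc (0 : ℝ) 1, f (0, t) = 0) (hfL : ∀ t ∈ Icc (0 : ℝ) 1, f (L, t) = 0)
    (hgw : ∀ x ∈ GamW L, g x = 0) : ∀ x ∈ Noz L, Q x = 0 := by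
  have hcl := closure_Noz hL
  have hIcc : Icc ((0, 0) : Pt) (L, 1) = closure (Noz L) := by rw [hcl, Icc_prod_Icc]
  have hmeas : MeasurableSet (Noz L) := (isOpen_Noz L).measurableSet
  have hae : Noz L =ᵐ[volume] closure (Noz L) := by
    rw [hcl]
    exact Measure.set_prod_ae_eq Ioo_ae_eq_Icc Ioo_ae_eq_Icc
  have hQi : IntegrableOn Q (closure (Noz L)) :=
    hQ.integrableOn_compact (hIcc ▸ isCompact_Icc)
  have hQi' : IntegrableOn Q (Noz L) := hQi.congr_set_ae hae
  have hdivi : IntegrableOn (fun x => fderiv ℝ f x (1, 0) + fderiv ℝ g x (0, 1))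
      (closure (Noz L)) :=
    (hQi'.congr_fun (fun x hx => (hdiv x hx).symm) hmeas).congr_set_ae hae.symm
  have hwall : ∀ s ∈ ({0, 1} : Set ℝ), ∫ x in (0 : ℝ)..L, g (x, s) = 0 := by
    intro s hs
    rw [intervalIntegral.integral_of_le hL.le, integral_Ioc_eq_integral_Ioo]
    exact setIntegral_eq_zero_of_forall_eq_zero fun x hx => hgw _ ⟨hx, hs⟩
  have hend : ∀ s, (∀ t ∈ Icc (0 : ℝ) 1, f (s, t) = 0) → ∫ t in (0 : ℝ)..1, f (s, t) = 0 := by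
    intro s hs
    rw [intervalIntegral.integral_of_le zero_le_one]
    exact setIntegral_eq_zero_of_forall_eq_zero fun t ht => hs t (Ioc_subset_Icc_self ht)
  have key := integral_divergence_prod_Icc_of_hasFDerivAt_off_countable_of_le f g
    (fderiv ℝ f) (fderiv ℝ g) ((0, 0) : Pt) (L, 1) ⟨hL.le, zero_le_one⟩ ∅ countable_empty
    (hIcc ▸ hf) (hIcc ▸ hg) (fun x hx => (hfd x hx.1).hasFDerivAt)
    (fun x hx => (hgd x hx.1).hasFDerivAt) (hIcc ▸ hdivi)
  rw [hwall 1 (by simp), hwall 0 (by simp), hend L hfL, hend 0 hf0, hIcc,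
    setIntegral_congr_set hae.symm] at key
  have hint : ∫ x in Noz L, Q x = 0 := by
    rw [← setIntegral_congr_fun hmeas fun x hx => hdiv x hx]
    simpa using! key
  rw [setIntegral_eq_zero_iff_of_nonneg_ae
    ((ae_restrict_mem hmeas).mono fun x hx => hQ0 x hx) hQi'] at hint
  exact Measure.eqOn_open_of_ae_eq hint (isOpen_Noz L) (hQ.mono subset_closure)
    continuousOn_const

theorem UpTo.continuousOn {m : ℕ} {f : Pt → ℝ} {K : Set Pt} (h : UpTo m f K) :
    ContinuousOn f K := by
  obtain ⟨U, -, hKU, hf⟩ := h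
  exact hf.continuousOn.mono hKU

theorem UpTo.differentiableAt {f : Pt → ℝ} {K : Set Pt} (h : UpTo 1 f K) {x : Pt} (hx : x ∈ K) :
    DifferentiableAt ℝ f x := by
  obtain ⟨U, hU, hKU, hf⟩ := h
  exact (hf.differentiableOn (by simp)).differentiableAt (hU.mem_nhds (hKU hx))

theorem UpTo.continuousOn_fderiv_apply {f : Pt → ℝ} {K : Set Pt} (h : UpTo 1 f K) (v : Pt) :
    ContinuousOn (fun x => fderiv ℝ f x v) K := by
  obtain ⟨U, hU, hKU, hf⟩ := h
  exact ((hf.continuousOn_fderiv_of_isOpen hU (by simp)).clm_apply continuousOn_const).mono hKU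

theorem differentiableAt_fderiv_apply {f : Pt → ℝ} {U : Set Pt} (hU : IsOpen U)
    (hf : ContDiffOn ℝ 2 f U) (v : Pt) {x : Pt} (hx : x ∈ U) :
    DifferentiableAt ℝ (fun y => fderiv ℝ f y v) x := by
  have h := (hf.fderiv_of_isOpen (m := 1) hU (by norm_num)).differentiableOn (by simp)
  exact (h.differentiableAt (hU.mem_nhds hx)).clm_apply (differentiableAt_const v)

theorem pd1_mul {f g : Pt → ℝ} {x : Pt} (hf : DifferentiableAt ℝ f x)
    (hg : DifferentiableAt ℝ g x) :
    pd1 (fun y => f y * g y) x = f x * pd1 g x + g x * pd1 f x := by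
  simp [pd1, fderiv_fun_mul hf hg]

theorem pd2_mul {f g : Pt → ℝ} {x : Pt} (hf : DifferentiableAt ℝ f x)
    (hg : DifferentiableAt ℝ g x) :
    pd2 (fun y => f y * g y) x = f x * pd2 g x + g x * pd2 f x := by
  simp [pd2, fderiv_fun_mul hf hg]

theorem pd1_add {f g : Pt → ℝ} {x : Pt} (hf : DifferentiableAt ℝ f x)
    (hg : DifferentiableAt ℝ g x) : pd1 (fun y => f y + g y) x = pd1 f x + pd1 g x := by
  simp [pd1, fderiv_fun_add hf hg]

theorem pd2_add {f g : Pt → ℝ} {x : Pt} (hf : DifferentiableAt ℝ f x)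
    (hg : DifferentiableAt ℝ g x) : pd2 (fun y => f y + g y) x = pd2 f x + pd2 g x := by
  simp [pd2, fderiv_fun_add hf hg]

/-- Energy identity and coercivity: uniqueness for the coupled system with diagonal principal
part, skew-symmetric first order coupling and coefficients depending on `x₁` only. -/
theorem eq_zero_of_coupled_system {L : ℝ} (hL : 0 < L) {a₁ a₂ b d : ℝ → ℝ}
    (ha₁ : DifferentiableOn ℝ a₁ (Icc 0 L)) (ha₂ : DifferentiableOn ℝ a₂ (Icc 0 L))
    (hb : DifferentiableOn ℝ b (Icc 0 L)) (hd : ContinuousOn d (Icc 0 L))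
    (ha₁_pos : ∀ s ∈ Icc 0 L, 0 < a₁ s) (ha₂_pos : ∀ s ∈ Icc 0 L, 0 < a₂ s)
    (hd_pos : ∀ s ∈ Icc 0 L, 0 < d s) {φ Ψ : Pt → ℝ}
    (hφreg : UpTo 1 φ (closure (Noz L))) (hΨreg : UpTo 1 Ψ (closure (Noz L)))
    (hφ2 : ContDiffOn ℝ 2 φ (Noz L)) (hΨ2 : ContDiffOn ℝ 2 Ψ (Noz L))
    (hL1 : ∀ x ∈ Noz L, pd1 (fun y => a₁ y.1 * pd1 φ y + Ψ y * b y.1) x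
      + pd2 (fun y => a₂ y.1 * pd2 φ y) x = 0)
    (hL2 : ∀ x ∈ Noz L, lap Ψ x = Ψ x * d x.1 - pd1 φ x * b x.1)
    (hbc1 : ∀ t ∈ Icc (0:ℝ) 1, φ (0, t) = 0 ∧ pd1 φ (L, t) = 0 ∧ Ψ (0, t) = 0 ∧ Ψ (L, t) = 0)
    (hbc2 : ∀ x ∈ GamW L, pd2 φ x = 0 ∧ pd2 Ψ x = 0) :
    ∀ x ∈ closure (Noz L), φ x = 0 ∧ Ψ x = 0 := by
  have hcl := closure_Noz hL
  have hfst : MapsTo Prod.fst (closure (Noz L)) (Icc 0 L) := by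
    rw [hcl]; exact fun x hx => hx.1
  have hcoef : ∀ {h : ℝ → ℝ}, ContinuousOn h (Icc 0 L) →
      ContinuousOn (fun x : Pt => h x.1) (closure (Noz L)) :=
    fun hh => hh.comp continuous_fst.continuousOn hfst
  have hcoefd : ∀ {h : ℝ → ℝ}, DifferentiableOn ℝ h (Icc 0 L) → ∀ x ∈ Noz L,
      DifferentiableAt ℝ (fun x : Pt => h x.1) x := fun hh x hx =>
    (hh.differentiableAt (Icc_mem_nhds hx.1.1 hx.1.2)).comp x differentiableAt_fst
  have hφc := hφreg.continuousOn
  have hΨc := hΨreg.continuousOn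
  have hφ1c : ContinuousOn (pd1 φ) _ := hφreg.continuousOn_fderiv_apply (1, 0)
  have hφ2c : ContinuousOn (pd2 φ) _ := hφreg.continuousOn_fderiv_apply (0, 1)
  have hΨ1c : ContinuousOn (pd1 Ψ) _ := hΨreg.continuousOn_fderiv_apply (1, 0)
  have hΨ2c : ContinuousOn (pd2 Ψ) _ := hΨreg.continuousOn_fderiv_apply (0, 1)
  have hφd : ∀ x ∈ Noz L, DifferentiableAt ℝ φ x :=
    fun x hx => hφreg.differentiableAt (subset_closure hx)
  have hΨd : ∀ x ∈ Noz L, DifferentiableAt ℝ Ψ x :=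
    fun x hx => hΨreg.differentiableAt (subset_closure hx)
  have hφ1d : ∀ x ∈ Noz L, DifferentiableAt ℝ (pd1 φ) x :=
    fun x hx => differentiableAt_fderiv_apply (isOpen_Noz L) hφ2 (1, 0) hx
  have hφ2d : ∀ x ∈ Noz L, DifferentiableAt ℝ (pd2 φ) x :=
    fun x hx => differentiableAt_fderiv_apply (isOpen_Noz L) hφ2 (0, 1) hx
  have hΨ1d : ∀ x ∈ Noz L, DifferentiableAt ℝ (pd1 Ψ) x :=
    fun x hx => differentiableAt_fderiv_apply (isOpen_Noz L) hΨ2 (1, 0) hx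
  have hΨ2d : ∀ x ∈ Noz L, DifferentiableAt ℝ (pd2 Ψ) x :=
    fun x hx => differentiableAt_fderiv_apply (isOpen_Noz L) hΨ2 (0, 1) hx
  set F₁ : Pt → ℝ := fun y => a₁ y.1 * pd1 φ y + Ψ y * b y.1 with hF₁
  set F₂ : Pt → ℝ := fun y => a₂ y.1 * pd2 φ y with hF₂
  have hF₁c : ContinuousOn F₁ (closure (Noz L)) :=
    ((hcoef ha₁.continuousOn).mul hφ1c).add (hΨc.mul (hcoef hb.continuousOn))
  have hF₂c : ContinuousOn F₂ (closure (Noz L)) := (hcoef ha₂.continuousOn).mul hφ2c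
  have hF₁d : ∀ x ∈ Noz L, DifferentiableAt ℝ F₁ x := fun x hx =>
    ((hcoefd ha₁ x hx).mul (hφ1d x hx)).add ((hΨd x hx).mul (hcoefd hb x hx))
  have hF₂d : ∀ x ∈ Noz L, DifferentiableAt ℝ F₂ x := fun x hx =>
    (hcoefd ha₂ x hx).mul (hφ2d x hx)
  have hQ := eq_zero_of_divergence_eq hL
    (f := fun y => φ y * F₁ y + Ψ y * pd1 Ψ y) (g := fun y => φ y * F₂ y + Ψ y * pd2 Ψ y)
    (Q := fun y => a₁ y.1 * pd1 φ y ^ 2 + a₂ y.1 * pd2 φ y ^ 2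
      + (pd1 Ψ y ^ 2 + pd2 Ψ y ^ 2) + d y.1 * Ψ y ^ 2)
    ((hφc.mul hF₁c).add (hΨc.mul hΨ1c)) ((hφc.mul hF₂c).add (hΨc.mul hΨ2c))
    (((((hcoef ha₁.continuousOn).mul (hφ1c.pow 2)).add
      ((hcoef ha₂.continuousOn).mul (hφ2c.pow 2))).add ((hΨ1c.pow 2).add (hΨ2c.pow 2))).add
      ((hcoef hd).mul (hΨc.pow 2)))
    (fun x hx => ((hφd x hx).mul (hF₁d x hx)).add ((hΨd x hx).mul (hΨ1d x hx)))
    (fun x hx => ((hφd x hx).mul (hF₂d x hx)).add ((hΨd x hx).mul (hΨ2d x hx)))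
    (by
      intro x hx
      rw [pd1_add ((hφd x hx).fun_mul (hF₁d x hx)) ((hΨd x hx).fun_mul (hΨ1d x hx)),
        pd2_add ((hφd x hx).fun_mul (hF₂d x hx)) ((hΨd x hx).fun_mul (hΨ2d x hx)),
        pd1_mul (hφd x hx) (hF₁d x hx), pd2_mul (hφd x hx) (hF₂d x hx),
        pd1_mul (hΨd x hx) (hΨ1d x hx), pd2_mul (hΨd x hx) (hΨ2d x hx)]
      have h1 := hL1 x hx
      have h2 := hL2 x hx
      simp only [lap] at h2
      have e1 : F₁ x = a₁ x.1 * pd1 φ x + Ψ x * b x.1 := rfl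
      have e2 : F₂ x = a₂ x.1 * pd2 φ x := rfl
      rw [e1, e2]
      linear_combination φ x * h1 + Ψ x * h2)
    (by
      intro x hx
      have hx' := hfst (subset_closure hx)
      have := ha₁_pos _ hx'
      have := ha₂_pos _ hx'
      have := hd_pos _ hx'
      positivity)
    (fun t ht => by simp [(hbc1 t ht).1, (hbc1 t ht).2.2.1])
    (fun t ht => by simp [hF₁, (hbc1 t ht).2.1, (hbc1 t ht).2.2.2])
    (fun x hx => by simp [hF₂, hbc2 x hx])
  have hpt : ∀ x ∈ Noz L, pd1 φ x = 0 ∧ Ψ x = 0 := by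
    intro x hx
    have hx' := hfst (subset_closure hx)
    have h0 := hQ x hx
    have p1 := ha₁_pos _ hx'
    have p2 := ha₂_pos _ hx'
    have p3 := hd_pos _ hx'
    have q1 : 0 ≤ a₁ x.1 * pd1 φ x ^ 2 := by positivity
    have q2 : 0 ≤ a₂ x.1 * pd2 φ x ^ 2 := by positivity
    have q3 : 0 ≤ d x.1 * Ψ x ^ 2 := by positivity
    have q4 : 0 ≤ pd1 Ψ x ^ 2 + pd2 Ψ x ^ 2 := by positivity
    have r1 : a₁ x.1 * pd1 φ x ^ 2 = 0 := by linarith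
    have r2 : d x.1 * Ψ x ^ 2 = 0 := by linarith
    exact ⟨by simpa [p1.ne'] using r1, by simpa [p3.ne'] using r2⟩
  have hφ0 : EqOn φ (fun _ => 0) (Noz L) := by
    rintro ⟨s, t⟩ ⟨hs, ht⟩
    have ht' : t ∈ Icc (0 : ℝ) 1 := Ioo_subset_Icc_self ht
    have hmem : ∀ r ∈ Icc 0 L, (r, t) ∈ closure (Noz L) := fun r hr => hcl ▸ ⟨hr, ht'⟩
    have hder : ∀ r ∈ Icc 0 L, HasDerivAt (fun r => φ (r, t)) (pd1 φ (r, t)) r := fun r hr =>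
      (hφreg.differentiableAt (hmem r hr)).hasFDerivAt.comp_hasDerivAt r
        ((hasDerivAt_id r).prodMk (hasDerivAt_const r t))
    have h := exists_hasDerivAt_eq_slope (fun r => φ (r, t)) (fun r => pd1 φ (r, t)) hs.1
      (fun r hr => (hder r ⟨hr.1, hr.2.trans hs.2.le⟩).continuousAt.continuousWithinAt)
      (fun r hr => hder r ⟨hr.1.le, (hr.2.trans hs.2).le⟩)
    obtain ⟨c, hc, hslope⟩ := h
    rw [(hpt (c, t) ⟨⟨hc.1, hc.2.trans hs.2⟩, ht⟩).1, (hbc1 t ht').1, eq_comm,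
      div_eq_zero_iff] at hslope
    have := hs.1
    rcases hslope with h | h
    · simpa using h
    · linarith
  have hΨ0 : EqOn Ψ (fun _ => 0) (Noz L) := fun x hx => (hpt x hx).2
  exact fun x hx => ⟨hφ0.of_subset_closure hφc continuousOn_const subset_closure subset_rfl hx,
    hΨ0.of_subset_closure hΨc continuousOn_const subset_closure subset_rfl hx⟩

theorem Hfun_apply {γ 𝔭 cv S ρ : ℝ} (hγ : 1 < γ) (h𝔭 : 0 < 𝔭) (hρ : 0 < ρ) :
    Hfun γ 𝔭 cv S (γ * 𝔭 * exp (S / cv) * ρ ^ (γ - 1) / (γ - 1)) = ρ := by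
  have hγ' : γ - 1 ≠ 0 := by linarith
  have hk : γ * 𝔭 * exp (S / cv) ≠ 0 := by positivity
  rw [Hfun, mul_div_cancel₀ _ hγ', mul_div_cancel_left₀ _ hk, one_div,
    rpow_rpow_inv hρ.le hγ']

theorem hasDerivAt_Hfun {γ 𝔭 cv S ρ : ℝ} (hγ : 1 < γ) (h𝔭 : 0 < 𝔭) (hρ : 0 < ρ) :
    HasDerivAt (Hfun γ 𝔭 cv S) (ρ / (γ * 𝔭 * exp (S / cv) * ρ ^ (γ - 1)))
      (γ * 𝔭 * exp (S / cv) * ρ ^ (γ - 1) / (γ - 1)) := by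
  have hγ' : γ - 1 ≠ 0 := by linarith
  have hk : γ * 𝔭 * exp (S / cv) ≠ 0 := by positivity
  have hpow : 0 < ρ ^ (γ - 1) := rpow_pos_of_pos hρ _
  have hval : (γ - 1) * (γ * 𝔭 * exp (S / cv) * ρ ^ (γ - 1) / (γ - 1)) / (γ * 𝔭 * exp (S / cv))
      = ρ ^ (γ - 1) := by
    rw [mul_div_cancel₀ _ hγ', mul_div_cancel_left₀ _ hk]
  have h := (((hasDerivAt_id (γ * 𝔭 * exp (S / cv) * ρ ^ (γ - 1) / (γ - 1))).const_mul
    (γ - 1)).div_const (γ * 𝔭 * exp (S / cv))).rpow_const (p := 1 / (γ - 1))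
    (Or.inl (by simpa only [id, hval] using hpow.ne'))
  refine h.congr_deriv ?_
  simp only [id, hval]
  rw [rpow_sub_one hpow.ne', one_div, rpow_rpow_inv hρ.le hγ']
  field_simp

/-- Derivative of the flux `B` along a curve of states through a background state of density `ρ`. -/
theorem hasDerivAt_Bflux {γ 𝔭 cv S K ρ z' q₁' q₂' : ℝ} (hγ : 1 < γ) (h𝔭 : 0 < 𝔭) (hρ : 0 < ρ)
    {z : ℝ → ℝ} {q : ℝ → Pt} (hz : HasDerivAt z z' 0)
    (hq₁ : HasDerivAt (fun t => (q t).1) q₁' 0) (hq₂ : HasDerivAt (fun t => (q t).2) q₂' 0)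
    (hq0 : (q 0).2 = 0)
    (hζ : K + z 0 - (q 0).1 ^ 2 / 2 = γ * 𝔭 * exp (S / cv) * ρ ^ (γ - 1) / (γ - 1)) :
    HasDerivAt (fun t => Bflux γ 𝔭 cv S K (z t) (q t) (0, 0))
      (ρ / (γ * 𝔭 * exp (S / cv) * ρ ^ (γ - 1)) * (z' - (q 0).1 * q₁')) 0 := by
  have hw : HasDerivAt (fun t => K + z t - (((q t).1 + 0) ^ 2 + ((q t).2 - 0) ^ 2) / 2)
      (z' - (q 0).1 * q₁') 0 := by
    refine ((hz.const_add K).sub ((((hq₁.add_const 0).pow 2).add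
      ((hq₂.sub_const 0).pow 2)).div_const 2)).congr_deriv ?_
    simp [hq0]
    ring
  refine (hasDerivAt_Hfun hγ h𝔭 hρ).comp_of_eq 0 hw ?_
  simpa [hq0] using hζ.symm

section Coefficients

variable {γ 𝔭 cv S₀ K₀ J₀ : ℝ} {ρb Eb : ℝ → ℝ} {x : Pt}

theorem coefd_eq (hγ : 1 < γ) (h𝔭 : 0 < 𝔭) (hρ : 0 < ρb x.1)
    (hζ : K₀ + Phi0 Eb x - (J₀ / ρb x.1) ^ 2 / 2 =
      γ * 𝔭 * exp (S₀ / cv) * ρb x.1 ^ (γ - 1) / (γ - 1)) :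
    coefd γ 𝔭 cv S₀ K₀ J₀ ρb Eb x = ρb x.1 / (γ * 𝔭 * exp (S₀ / cv) * ρb x.1 ^ (γ - 1)) := by
  have h := hasDerivAt_Bflux hγ h𝔭 hρ (z := fun t => Phi0 Eb x + t)
    (q := fun _ => (J₀ / ρb x.1, 0)) ((hasDerivAt_id 0).const_add _) (hasDerivAt_const _ _)
    (hasDerivAt_const _ _) rfl (by simpa using hζ)
  rw [coefd, h.deriv]
  ring

theorem coefb_eq (hγ : 1 < γ) (h𝔭 : 0 < 𝔭) (hρ : 0 < ρb x.1)
    (hζ : K₀ + Phi0 Eb x - (J₀ / ρb x.1) ^ 2 / 2 =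
      γ * 𝔭 * exp (S₀ / cv) * ρb x.1 ^ (γ - 1) / (γ - 1)) (i : Fin 2) :
    coefb γ 𝔭 cv S₀ K₀ J₀ ρb Eb i x = if i = 0 then
      ρb x.1 / (γ * 𝔭 * exp (S₀ / cv) * ρb x.1 ^ (γ - 1)) * (J₀ / ρb x.1) else 0 := by
  have h := hasDerivAt_Bflux hγ h𝔭 hρ (z := fun t => Phi0 Eb x + t)
    (q := fun _ => (J₀ / ρb x.1, 0)) ((hasDerivAt_id 0).const_add _) (hasDerivAt_const _ _)
    (hasDerivAt_const _ _) rfl (by simpa using hζ)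
  unfold coefb Aflux
  rw [(h.mul_const _).deriv]
  split_ifs <;> ring

/-- At the background state the flux `B` has derivative `-ρu/c²` in the direction `q₁` and `0` in
the direction `q₂`. -/
theorem hasDerivAt_Bflux_evec (hγ : 1 < γ) (h𝔭 : 0 < 𝔭) (hρ : 0 < ρb x.1)
    (hζ : K₀ + Phi0 Eb x - (J₀ / ρb x.1) ^ 2 / 2 =
      γ * 𝔭 * exp (S₀ / cv) * ρb x.1 ^ (γ - 1) / (γ - 1)) (j : Fin 2) :
    HasDerivAt
      (fun t : ℝ => Bflux γ 𝔭 cv S₀ K₀ (Phi0 Eb x) ((J₀ / ρb x.1, 0) + t • evec j) (0, 0))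
      (if j = 0 then -(ρb x.1 / (γ * 𝔭 * exp (S₀ / cv) * ρb x.1 ^ (γ - 1)) * (J₀ / ρb x.1))
        else 0) 0 := by
  have h := hasDerivAt_Bflux hγ h𝔭 hρ (z := fun _ => Phi0 Eb x)
    (q := fun t => (J₀ / ρb x.1, 0) + t • evec j) (hasDerivAt_const _ _)
    (((hasDerivAt_id 0).mul_const (evec j).1).const_add (J₀ / ρb x.1))
    (((hasDerivAt_id 0).mul_const (evec j).2).const_add 0) (by simp) (by simpa using hζ)
  refine h.congr_deriv ?_
  by_cases hj : j = 0 <;> simp [hj, evec]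

theorem coefc_eq (hγ : 1 < γ) (h𝔭 : 0 < 𝔭) (hρ : 0 < ρb x.1)
    (hζ : K₀ + Phi0 Eb x - (J₀ / ρb x.1) ^ 2 / 2 =
      γ * 𝔭 * exp (S₀ / cv) * ρb x.1 ^ (γ - 1) / (γ - 1)) (i : Fin 2) :
    coefc γ 𝔭 cv S₀ K₀ J₀ ρb Eb i x = if i = 0 then
      -(ρb x.1 / (γ * 𝔭 * exp (S₀ / cv) * ρb x.1 ^ (γ - 1)) * (J₀ / ρb x.1)) else 0 :=
  (hasDerivAt_Bflux_evec hγ h𝔭 hρ hζ i).deriv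

theorem coefa_eq (hγ : 1 < γ) (h𝔭 : 0 < 𝔭) (hρ : 0 < ρb x.1)
    (hζ : K₀ + Phi0 Eb x - (J₀ / ρb x.1) ^ 2 / 2 =
      γ * 𝔭 * exp (S₀ / cv) * ρb x.1 ^ (γ - 1) / (γ - 1)) (i j : Fin 2) :
    coefa γ 𝔭 cv S₀ K₀ J₀ ρb Eb i j x = if i = j then (if i = 0 then
      ρb x.1 - ρb x.1 / (γ * 𝔭 * exp (S₀ / cv) * ρb x.1 ^ (γ - 1)) * (J₀ / ρb x.1) ^ 2
      else ρb x.1) else 0 := by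
  have hB : Bflux γ 𝔭 cv S₀ K₀ (Phi0 Eb x) (J₀ / ρb x.1, 0) (0, 0) = ρb x.1 := by
    simpa [Bflux, hζ] using Hfun_apply hγ h𝔭 hρ
  have hq : HasDerivAt (fun t : ℝ => if i = 0 then ((J₀ / ρb x.1, (0 : ℝ)) + t • evec j).1
      else ((J₀ / ρb x.1, (0 : ℝ)) + t • evec j).2) (if i = j then 1 else 0) 0 := by
    have h₁ : HasDerivAt (fun t : ℝ => ((J₀ / ρb x.1, (0 : ℝ)) + t • evec j).1) (evec j).1 0 := by
      simpa using ((hasDerivAt_id (0 : ℝ)).mul_const (evec j).1).const_add (J₀ / ρb x.1)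
    have h₂ : HasDerivAt (fun t : ℝ => ((J₀ / ρb x.1, (0 : ℝ)) + t • evec j).2) (evec j).2 0 := by
      simpa using ((hasDerivAt_id (0 : ℝ)).mul_const (evec j).2).const_add 0
    fin_cases i
    · fin_cases j <;> simpa [evec] using! h₁
    · fin_cases j <;> simpa [evec] using! h₂
  unfold coefa Aflux
  rw [((hasDerivAt_Bflux_evec hγ h𝔭 hρ hζ j).fun_mul hq).deriv]
  fin_cases i <;> fin_cases j <;> simp [hB]
  ring

end Coefficients

section Bernoulli

variable {γ 𝔭 cv b₀ J₀ S₀ E₀ ρ₀ L ν₀ ρlow ρhigh : ℝ} {ρb Eb : ℝ → ℝ}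

theorem Background.rho_pos (hbg : Background γ 𝔭 cv b₀ J₀ S₀ E₀ ρ₀ L ν₀ ρlow ρhigh ρb Eb)
    {s : ℝ} (hs : s ∈ Icc 0 L) : 0 < ρb s :=
  hbg.hρlow.trans_le (hbg.bound_lo s hs)

/-- Conservation of the Bernoulli quantity along the background solution. -/
theorem Background.bernoulli (hbg : Background γ 𝔭 cv b₀ J₀ S₀ E₀ ρ₀ L ν₀ ρlow ρhigh ρb Eb)
    {s : ℝ} (hs : s ∈ Icc 0 L) :
    Bern0 γ 𝔭 cv S₀ J₀ ρ₀ + (∫ t in (0 : ℝ)..s, Eb t) - (J₀ / ρb s) ^ 2 / 2 =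
      γ * 𝔭 * exp (S₀ / cv) * ρb s ^ (γ - 1) / (γ - 1) := by
  have hsub : Icc 0 s ⊆ Icc 0 L := Icc_subset_Icc_right hs.2
  have hγ' : γ - 1 ≠ 0 := by linarith [hbg.hγ]
  have hdiff : DifferentiableOn ℝ ρb (Icc 0 L) := hbg.smooth_rho.differentiableOn (by simp)
  have hcont : ContinuousOn ρb (Icc 0 s) := hdiff.continuousOn.mono hsub
  have hne : ∀ r ∈ Icc 0 s, ρb r ≠ 0 := fun r hr => (hbg.rho_pos (hsub hr)).ne'
  have h := intervalIntegral.integral_eq_sub_of_hasDerivAt_of_le (f' := Eb)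
    (f := fun r => (J₀ / ρb r) ^ 2 / 2 + γ * 𝔭 * exp (S₀ / cv) * ρb r ^ (γ - 1) / (γ - 1)) hs.1
    (((continuousOn_const.div hcont hne).pow 2).div_const 2 |>.add
      ((continuousOn_const.mul (hcont.rpow_const fun r hr => Or.inl (hne r hr))).div_const _))
    (by
      intro r hr
      have hr' : r ∈ Icc 0 L := hsub (Ioo_subset_Icc_self hr)
      have hnhds : Icc 0 L ∈ nhds r := Icc_mem_nhds hr.1 (hr.2.trans_le hs.2)
      have hpos := hbg.rho_pos hr'
      have hρ : HasDerivAt ρb (deriv ρb r) r := (hdiff.differentiableAt hnhds).hasDerivAt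
      have hode := hbg.ode_rho r hr'
      rw [derivWithin_of_mem_nhds hnhds,
        eq_div_iff (hbg.hν₀.trans_le (hbg.subsonic r hr')).ne'] at hode
      refine (((((hasDerivAt_const r J₀).div hρ hpos.ne').pow 2).div_const 2).add
        (((hρ.rpow_const (p := γ - 1) (Or.inl hpos.ne')).const_mul
          (γ * 𝔭 * exp (S₀ / cv))).div_const (γ - 1))).congr_deriv ?_
      rw [rpow_sub_one hpos.ne']
      generalize ρb r ^ (γ - 1) = P at hode ⊢
      simp only [Pi.div_apply, Nat.cast_ofNat, Nat.add_one_sub_one, pow_one, zero_mul, zero_sub]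
      field_simp at hode ⊢
      linear_combination hode)
    ((hbg.smooth_E.continuousOn.mono hsub).intervalIntegrable_of_Icc hs.1)
  rw [h, Bern0, hbg.init_rho]
  ring

end Bernoulli

/-- uniqueness for the homogeneous linearized problem. Let
`L₁(Ψ,φ) = Σ_i ∂_i(Σ_j 𝔞_{ij}∂_jφ + Ψ𝔟_i)` and `L₂(Ψ,φ) = ΔΨ − (Ψ𝔡 + ∇φ·𝔠)` be the
operators obtained by linearizing the reformulated Euler–Poisson system at the subsonic
background. If `(φ,Ψ) ∈ (C¹(N̄) ∩ C²(N))²` satisfies `L₁(Ψ,φ) = 0` and `L₂(Ψ,φ) = 0` in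
`N` together with the homogeneous boundary conditions `φ = 0` on `Γ₀`, `∂₂φ = 0` on
`Γ_w`, `∂₁φ = 0` on `Γ_L`, `Ψ = 0` on `Γ₀ ∪ Γ_L`, `∂₂Ψ = 0` on `Γ_w`, then `φ ≡ 0` and
`Ψ ≡ 0` on `N̄`. -/
theorem stmt19 (γ 𝔭 cv b₀ J₀ S₀ E₀ ρ₀ L ν₀ ρlow ρhigh K₀ : ℝ) (ρb Eb : ℝ → ℝ)
    (hbg : Background γ 𝔭 cv b₀ J₀ S₀ E₀ ρ₀ L ν₀ ρlow ρhigh ρb Eb)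
    (hK₀ : K₀ = Bern0 γ 𝔭 cv S₀ J₀ ρ₀)
    (φ Ψ : Pt → ℝ)
    (hφreg : UpTo 1 φ (closure (Noz L))) (hΨreg : UpTo 1 Ψ (closure (Noz L)))
    (hφ2 : ContDiffOn ℝ 2 φ (Noz L)) (hΨ2 : ContDiffOn ℝ 2 Ψ (Noz L))
    -- `L₁(Ψ, φ) = 0` in `N`
    (hL1 : ∀ x ∈ Noz L,
      pd1 (fun y => coefa γ 𝔭 cv S₀ K₀ J₀ ρb Eb 0 0 y * pd1 φ y
          + coefa γ 𝔭 cv S₀ K₀ J₀ ρb Eb 0 1 y * pd2 φ y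
          + Ψ y * coefb γ 𝔭 cv S₀ K₀ J₀ ρb Eb 0 y) x
      + pd2 (fun y => coefa γ 𝔭 cv S₀ K₀ J₀ ρb Eb 1 0 y * pd1 φ y
          + coefa γ 𝔭 cv S₀ K₀ J₀ ρb Eb 1 1 y * pd2 φ y
          + Ψ y * coefb γ 𝔭 cv S₀ K₀ J₀ ρb Eb 1 y) x = 0)
    -- `L₂(Ψ, φ) = 0` in `N`
    (hL2 : ∀ x ∈ Noz L,
      lap Ψ x - (Ψ x * coefd γ 𝔭 cv S₀ K₀ J₀ ρb Eb x
          + pd1 φ x * coefc γ 𝔭 cv S₀ K₀ J₀ ρb Eb 0 x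
          + pd2 φ x * coefc γ 𝔭 cv S₀ K₀ J₀ ρb Eb 1 x) = 0)
    -- homogeneous boundary conditions
    (hbc1 : ∀ t ∈ Icc (0:ℝ) 1, φ (0, t) = 0 ∧ pd1 φ (L, t) = 0 ∧ Ψ (0, t) = 0 ∧ Ψ (L, t) = 0)
    (hbc2 : ∀ x ∈ GamW L, pd2 φ x = 0 ∧ pd2 Ψ x = 0) :
    ∀ x ∈ closure (Noz L), φ x = 0 ∧ Ψ x = 0 := by
  have hγ := hbg.hγ
  have h𝔭 := hbg.h𝔭
  have hk : 0 < γ * 𝔭 * exp (S₀ / cv) := by positivity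
  have hρd : DifferentiableOn ℝ ρb (Icc 0 L) := hbg.smooth_rho.differentiableOn (by simp)
  have hρpos : ∀ s ∈ Icc 0 L, 0 < ρb s := fun s hs => hbg.rho_pos hs
  have hpow : DifferentiableOn ℝ (fun s => ρb s ^ (γ - 1)) (Icc 0 L) :=
    hρd.rpow_const fun s hs => Or.inl (hρpos s hs).ne'
  set d : ℝ → ℝ := fun s => ρb s / (γ * 𝔭 * exp (S₀ / cv) * ρb s ^ (γ - 1)) with hd
  have hd_pos : ∀ s ∈ Icc 0 L, 0 < d s := fun s hs => by
    have := hρpos s hs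
    positivity
  have hd_diff : DifferentiableOn ℝ d (Icc 0 L) :=
    hρd.div (hpow.const_mul _) fun s hs => by
      have := hρpos s hs
      positivity
  have hu : DifferentiableOn ℝ (fun s => J₀ / ρb s) (Icc 0 L) :=
    (differentiableOn_const J₀).div hρd fun s hs => (hρpos s hs).ne'
  have hNoz : ∀ x ∈ Noz L, x.1 ∈ Icc 0 L := fun x hx => Ioo_subset_Icc_self hx.1
  have hζ : ∀ x ∈ Noz L, K₀ + Phi0 Eb x - (J₀ / ρb x.1) ^ 2 / 2 =
      γ * 𝔭 * exp (S₀ / cv) * ρb x.1 ^ (γ - 1) / (γ - 1) := fun x hx =>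
    hK₀ ▸ hbg.bernoulli (hNoz x hx)
  refine eq_zero_of_coupled_system hbg.hL (a₁ := fun s => ρb s - d s * (J₀ / ρb s) ^ 2)
    (a₂ := ρb) (b := fun s => d s * (J₀ / ρb s)) (d := d) (hρd.sub (hd_diff.mul (hu.pow 2))) hρd
    (hd_diff.mul hu) hd_diff.continuousOn ?_ hρpos hd_pos hφreg hΨreg hφ2 hΨ2 ?_ ?_ hbc1 hbc2
  · intro s hs
    have hsub := hbg.hν₀.trans_le (hbg.subsonic s hs)
    have hρs := hρpos s hs
    have hfac : ρb s - d s * (J₀ / ρb s) ^ 2 =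
        d s * (γ * 𝔭 * exp (S₀ / cv) * ρb s ^ (γ - 1) - J₀ ^ 2 / ρb s ^ 2) := by
      have : ρb s ^ (γ - 1) ≠ 0 := (rpow_pos_of_pos hρs _).ne'
      simp only [hd]
      field_simp
    simpa only [hfac] using mul_pos (hd_pos s hs) hsub
  · intro x hx
    rw [← hL1 x hx]
    have hnhds := (isOpen_Noz L).mem_nhds hx
    unfold pd1 pd2
    congr 2
    · refine Filter.EventuallyEq.fderiv_eq ?_
      filter_upwards [hnhds] with y hy
      have hρy := hρpos _ (hNoz y hy)
      simp [coefa_eq hγ h𝔭 hρy (hζ y hy), coefb_eq hγ h𝔭 hρy (hζ y hy), hd]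
    · refine Filter.EventuallyEq.fderiv_eq ?_
      filter_upwards [hnhds] with y hy
      have hρy := hρpos _ (hNoz y hy)
      simp [coefa_eq hγ h𝔭 hρy (hζ y hy), coefb_eq hγ h𝔭 hρy (hζ y hy)]
  · intro x hx
    have hρx := hρpos _ (hNoz x hx)
    have h := hL2 x hx
    rw [coefd_eq hγ h𝔭 hρx (hζ x hx), coefc_eq hγ h𝔭 hρx (hζ x hx),
      coefc_eq hγ h𝔭 hρx (hζ x hx), if_pos rfl, if_neg one_ne_zero] at h
    simp only [hd]
    linear_combination h
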